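/- arXiv:0911.2205 — 11 statements merged into one kernel-verified Lean document; each statement's English description precedes it below -/
import Mathlib

section
/- Let Q, P, ω : ℝ → M₃(ℝ) be families of 3×3 real matrices with Q and P differentiable and ω continuous, satisfying the SO(3) geodesic equations Q′(t) = ω(t)·Q(t) and P′(t) = −ω(t)ᵀ·P(t) for all t ∈ ℝ. Then the right-action momentum t ↦ trace(P(t)ᵀ·Q(t)·w) is constant in t, i.e. trace(P(t)ᵀQ(t)w) = trace(P(0)ᵀQ(0)w) for all t. -/
open Matrix

attribute [local instance] Matrix.normedAddCommGroup Matrix.normedSpace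

/-- The generator of rotations about the z-axis in 𝔰𝔬(3). -/
noncomputable def wz : Matrix (Fin 3) (Fin 3) ℝ := !![0, 1, 0; -1, 0, 0; 0, 0, 0]

theorem hasDerivAt_matrix_entry {m n : Type*} [Fintype m] [Fintype n]
    {A : ℝ → Matrix m n ℝ} {A' : Matrix m n ℝ} {t : ℝ} (h : HasDerivAt A A' t) (i : m) (j : n) :
    HasDerivAt (fun s => A s i j) (A' i j) t :=
  hasDerivAt_pi.1 (hasDerivAt_pi.1 h i) j

/-- A solution of `Q' = ωQ` paired with a solution of the adjoint equation `P' = -ωᵀP` gives a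
constant matrix `PᵀQ`. -/
theorem transpose_mul_eq_of_hasDerivAt_adjoint {n : Type*} [Fintype n]
    {Q P ω : ℝ → Matrix n n ℝ}
    (hQ : ∀ t : ℝ, HasDerivAt Q (ω t * Q t) t)
    (hP : ∀ t : ℝ, HasDerivAt P (-(ω t)ᵀ * P t) t) (s t : ℝ) :
    (P s)ᵀ * Q s = (P t)ᵀ * Q t := by
  ext i j
  have key : ∀ r, HasDerivAt (fun r => ((P r)ᵀ * Q r) i j) 0 r := fun r => by
    have h := HasDerivAt.fun_sum (u := Finset.univ) fun k _ =>
      (hasDerivAt_matrix_entry (hP r) k i).fun_mul (hasDerivAt_matrix_entry (hQ r) k j)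
    have h0 : (-(ω r)ᵀ * P r)ᵀ * Q r + (P r)ᵀ * (ω r * Q r) = 0 := by
      simp [Matrix.transpose_mul, Matrix.mul_assoc]
    rw [Finset.sum_add_distrib] at h
    exact h.congr_deriv (congrFun (congrFun h0 i) j)
  exact is_const_of_deriv_eq_zero (fun r => (key r).differentiableAt) (fun r => (key r).deriv) s t

/-- Conservation of the right-action momentum `trace(PᵀQw)` along the SO(3)
geodesic equations `Q' = ωQ`, `P' = -ωᵀP`. -/
theorem so3_momentum_conserved
    (Q P ω : ℝ → Matrix (Fin 3) (Fin 3) ℝ)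
    (hω : Continuous ω)
    (hQ : ∀ t : ℝ, HasDerivAt Q (ω t * Q t) t)
    (hP : ∀ t : ℝ, HasDerivAt P (-(ω t)ᵀ * P t) t) :
    ∀ t : ℝ, ((P t)ᵀ * Q t * wz).trace = ((P 0)ᵀ * Q 0 * wz).trace := by
  intro t
  rw [transpose_mul_eq_of_hasDerivAt_adjoint hQ hP t 0]
end

section
/- Let Q, P, ω : ℝ → M₃(ℝ) with Q and P differentiable and ω continuous, satisfying Q′(t) = ω(t)·Q(t) and P′(t) = −ω(t)ᵀ·P(t) for all t. If the endpoint condition trace(P(1)ᵀ·Q(1)·w) = 0 holds, then trace(P(t)ᵀ·Q(t)·w) = 0 for all t ∈ [0,1]. -/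
open Matrix

attribute [local instance] Matrix.normedAddCommGroup Matrix.normedSpace

/-- If `Q' = ωQ` and `P' = -ωᵀP`, then `PᵀQ` has zero derivative entrywise. -/
theorem hasDerivAt_transpose_mul_apply_zero {n : Type*} [Fintype n]
    {Q P : ℝ → Matrix n n ℝ} {A : Matrix n n ℝ} {t : ℝ}
    (hQ : HasDerivAt Q (A * Q t) t) (hP : HasDerivAt P (-Aᵀ * P t) t) (i j : n) :
    HasDerivAt (fun s => ((P s)ᵀ * Q s) i j) 0 t := by
  have hQ' (k l : n) : HasDerivAt (fun s => Q s k l) ((A * Q t) k l) t :=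
    hasDerivAt_pi.1 (hasDerivAt_pi.1 hQ k) l
  have hP' (k l : n) : HasDerivAt (fun s => P s k l) ((-Aᵀ * P t) k l) t :=
    hasDerivAt_pi.1 (hasDerivAt_pi.1 hP k) l
  have h := HasDerivAt.fun_sum (u := Finset.univ) fun k _ => (hP' k i).mul (hQ' k j)
  have hzero : (-Aᵀ * P t)ᵀ * Q t + (P t)ᵀ * (A * Q t) = 0 := by
    simp [Matrix.transpose_mul, Matrix.mul_assoc]
  rw [Finset.sum_add_distrib] at h
  exact HasDerivAt.congr_deriv h (congrFun (congrFun hzero i) j)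

/-- If `Q' = ωQ` and `P' = -ωᵀP`, then `PᵀQ` is constant. -/
theorem transpose_mul_eq_of_hasDerivAt {n : Type*} [Fintype n]
    {Q P ω : ℝ → Matrix n n ℝ} (hQ : ∀ t, HasDerivAt Q (ω t * Q t) t)
    (hP : ∀ t, HasDerivAt P (-(ω t)ᵀ * P t) t) (s t : ℝ) :
    (P s)ᵀ * Q s = (P t)ᵀ * Q t := by
  ext i j
  have h (r : ℝ) := hasDerivAt_transpose_mul_apply_zero (hQ r) (hP r) i j
  exact is_const_of_deriv_eq_zero (fun r => (h r).differentiableAt) (fun r => (h r).deriv) s t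

/-- Vanishing momentum: if the right-action momentum `trace(PᵀQw)` vanishes at the
endpoint `t = 1`, then it vanishes on all of `[0,1]` along the SO(3) geodesic
equations `Q' = ωQ`, `P' = -ωᵀP`. -/
theorem so3_vanishing_momentum
    (Q P ω : ℝ → Matrix (Fin 3) (Fin 3) ℝ)
    (hω : Continuous ω)
    (hQ : ∀ t : ℝ, HasDerivAt Q (ω t * Q t) t)
    (hP : ∀ t : ℝ, HasDerivAt P (-(ω t)ᵀ * P t) t)
    (hend : ((P 1)ᵀ * Q 1 * wz).trace = 0) :
    ∀ t ∈ Set.Icc (0 : ℝ) 1, ((P t)ᵀ * Q t * wz).trace = 0 := by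
  intro t _
  rw [transpose_mul_eq_of_hasDerivAt hQ hP t 1, hend]
end

section
/- Let Q, P, ω : ℝ → M₃(ℝ) with Q and P differentiable, ω continuous, and ω(t) antisymmetric (ω(t)ᵀ = −ω(t)) for all t, satisfying Q′(t) = ω(t)·Q(t) and P′(t) = −ω(t)ᵀ·P(t). Define M(t) := (Q(t)·P(t)ᵀ − P(t)·Q(t)ᵀ)/2. Then M is differentiable and satisfies the Euler rigid-body (Euler–Poincaré) equation in matrix form: M′(t) = ω(t)·M(t) − M(t)·ω(t) for all t. -/
open Matrix

attribute [local instance] Matrix.normedAddCommGroup Matrix.normedSpace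

/-- A matrix-valued curve is differentiable iff each of its entries is. -/
theorem Matrix.hasDerivAt_iff {m n : Type*} [Fintype m] [Fintype n]
    {A : ℝ → Matrix m n ℝ} {A' : Matrix m n ℝ} {t : ℝ} :
    HasDerivAt A A' t ↔ ∀ i j, HasDerivAt (fun s => A s i j) (A' i j) t :=
  (hasDerivAt_pi (φ := fun s i => A s i) (φ' := fun i => A' i)).trans
    (forall_congr' fun _ => hasDerivAt_pi)

/-- Product rule for `A * Bᵀ`. -/
theorem HasDerivAt.matrix_mul_transpose {l m n : Type*} [Fintype l] [Fintype m] [Fintype n]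
    {A : ℝ → Matrix l m ℝ} {B : ℝ → Matrix n m ℝ} {A' : Matrix l m ℝ} {B' : Matrix n m ℝ}
    {t : ℝ} (hA : HasDerivAt A A' t) (hB : HasDerivAt B B' t) :
    HasDerivAt (fun s => A s * (B s)ᵀ) (A' * (B t)ᵀ + A t * B'ᵀ) t := by
  rw [Matrix.hasDerivAt_iff] at hA hB ⊢
  intro i j
  simp only [Matrix.add_apply, Matrix.mul_apply, Matrix.transpose_apply,
    ← Finset.sum_add_distrib]
  exact HasDerivAt.fun_sum fun k _ => (hA i k).mul (hB j k)

/-- The Euler rigid-body (Euler–Poincaré) equation for the left-action momentum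
`M = (QPᵀ - PQᵀ)/2` along the SO(3) geodesic equations `Q' = ωQ`, `P' = -ωᵀP`,
with `ω(t)` antisymmetric: `M' = ωM - Mω`. -/
theorem so3_euler_poincare
    (Q P ω : ℝ → Matrix (Fin 3) (Fin 3) ℝ)
    (hω : Continuous ω)
    (hωanti : ∀ t : ℝ, (ω t)ᵀ = -ω t)
    (hQ : ∀ t : ℝ, HasDerivAt Q (ω t * Q t) t)
    (hP : ∀ t : ℝ, HasDerivAt P (-(ω t)ᵀ * P t) t)
    (M : ℝ → Matrix (Fin 3) (Fin 3) ℝ)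
    (hM : M = fun t => (2⁻¹ : ℝ) • (Q t * (P t)ᵀ - P t * (Q t)ᵀ)) :
    ∀ t : ℝ, HasDerivAt M (ω t * M t - M t * ω t) t := by
  intro t
  subst hM
  have h := (((hQ t).matrix_mul_transpose (hP t)).sub
    ((hP t).matrix_mul_transpose (hQ t))).const_smul (2⁻¹ : ℝ)
  refine h.congr_deriv ?_
  simp only [hωanti t, neg_neg, Matrix.transpose_mul, Matrix.mul_smul, Matrix.smul_mul,
    ← smul_sub]
  congr 1
  noncomm_ring
end

section
/- Fix θ ∈ ℝ and set ν := θ·w. Let Q̄, P̄, ω̄ : ℝ → M₃(ℝ) with Q̄ and P̄ differentiable and ω̄ continuous, satisfying the reparameterised SO(3) geodesic equations Q̄′(t) = ω̄(t)·Q̄(t) + Q̄(t)·ν and P̄′(t) = −ω̄(t)ᵀ·P̄(t) + P̄(t)·ν for all t. Then t ↦ trace(P̄(t)ᵀ·Q̄(t)·w) is constant in t. -/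
open Matrix

attribute [local instance] Matrix.normedAddCommGroup Matrix.normedSpace

/-- The product rule for the trilinear pairing `trace(AᵀBC)` with `C` constant. -/
theorem hasDerivAt_trace_transpose_mul_mul {n : Type*} [Fintype n]
    {A B : ℝ → Matrix n n ℝ} {A' B' : Matrix n n ℝ} {t : ℝ} (C : Matrix n n ℝ)
    (hA : HasDerivAt A A' t) (hB : HasDerivAt B B' t) :
    HasDerivAt (fun s => ((A s)ᵀ * B s * C).trace)
      ((A'ᵀ * B t * C).trace + ((A t)ᵀ * B' * C).trace) t := by
  have hA_entry (i j : n) : HasDerivAt (fun s => A s i j) (A' i j) t :=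
    hasDerivAt_pi.1 (hasDerivAt_pi.1 hA i) j
  have hB_entry (i j : n) : HasDerivAt (fun s => B s i j) (B' i j) t :=
    hasDerivAt_pi.1 (hasDerivAt_pi.1 hB i) j
  simp only [Matrix.trace, Matrix.diag_apply, Matrix.mul_apply, Matrix.transpose_apply,
    ← Finset.sum_add_distrib, ← add_mul]
  exact HasDerivAt.fun_sum fun i _ => HasDerivAt.fun_sum fun j _ =>
    (HasDerivAt.fun_sum fun k _ => (hA_entry k i).fun_mul (hB_entry k j)).mul_const (C j i)

theorem wz_transpose : wzᵀ = -wz := by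
  ext i j
  fin_cases i <;> fin_cases j <;> simp [wz]

/-- Noether's theorem for the reparameterised SO(3) geodesic equations
`Q̄' = ω̄Q̄ + Q̄ν`, `P̄' = -ω̄ᵀP̄ + P̄ν` with `ν = θw`: the right-action momentum
`trace(P̄ᵀQ̄w)` is constant in time. -/
theorem so3_reparam_momentum_conserved
    (θ : ℝ) (ν : Matrix (Fin 3) (Fin 3) ℝ) (hν : ν = θ • wz)
    (Qb Pb ωb : ℝ → Matrix (Fin 3) (Fin 3) ℝ)
    (hωb : Continuous ωb)
    (hQb : ∀ t : ℝ, HasDerivAt Qb (ωb t * Qb t + Qb t * ν) t)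
    (hPb : ∀ t : ℝ, HasDerivAt Pb (-(ωb t)ᵀ * Pb t + Pb t * ν) t) :
    ∀ t : ℝ, ((Pb t)ᵀ * Qb t * wz).trace = ((Pb 0)ᵀ * Qb 0 * wz).trace := by
  subst hν
  have hderiv (t : ℝ) : HasDerivAt (fun s => ((Pb s)ᵀ * Qb s * wz).trace) 0 t := by
    convert hasDerivAt_trace_transpose_mul_mul wz (hPb t) (hQb t) using 1
    have hcycl := Matrix.trace_mul_comm wz ((Pb t)ᵀ * Qb t * wz)
    simp only [Matrix.mul_assoc] at hcycl
    simp [wz_transpose, Matrix.add_mul, Matrix.mul_add, Matrix.mul_assoc, hcycl]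
    ring
  exact fun t => is_const_of_deriv_eq_zero (fun s => (hderiv s).differentiableAt)
    (fun s => (hderiv s).deriv) t 0
end

section
/- Fix θ ∈ ℝ and set ν := θ·w. Let Q̄, P̄, ω̄ : ℝ → M₃(ℝ) with Q̄ and P̄ differentiable, ω̄ continuous, and ω̄(t) antisymmetric for all t, satisfying Q̄′(t) = ω̄(t)·Q̄(t) + Q̄(t)·ν and P̄′(t) = −ω̄(t)ᵀ·P̄(t) + P̄(t)·ν. Define M̄(t) := (Q̄(t)·P̄(t)ᵀ − P̄(t)·Q̄(t)ᵀ)/2. Then all terms involving ν cancel and M̄ satisfies the same Euler rigid-body equation as in the unreparameterised problem: M̄′(t) = ω̄(t)·M̄(t) − M̄(t)·ω̄(t) for all t. -/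
open Matrix

attribute [local instance] Matrix.normedAddCommGroup Matrix.normedSpace

theorem HasDerivAt.matrix_transpose {m n : Type*} [Fintype m] [Fintype n]
    {A : ℝ → Matrix m n ℝ} {A' : Matrix m n ℝ} {t : ℝ} (hA : HasDerivAt A A' t) :
    HasDerivAt (fun s => (A s)ᵀ) A'ᵀ t :=
  hasDerivAt_pi.2 fun i => hasDerivAt_pi.2 fun j => hasDerivAt_pi.1 (hasDerivAt_pi.1 hA j) i

theorem HasDerivAt.matrix_mul {l m n : Type*} [Fintype l] [Fintype m] [Fintype n]
    {A : ℝ → Matrix l m ℝ} {B : ℝ → Matrix m n ℝ} {A' : Matrix l m ℝ} {B' : Matrix m n ℝ}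
    {t : ℝ} (hA : HasDerivAt A A' t) (hB : HasDerivAt B B' t) :
    HasDerivAt (fun s => A s * B s) (A' * B t + A t * B') t := by
  refine hasDerivAt_pi.2 fun i => hasDerivAt_pi.2 fun j => ?_
  have h := HasDerivAt.fun_sum (u := Finset.univ) fun k _ =>
    (hasDerivAt_pi.1 (hasDerivAt_pi.1 hA i) k).mul (hasDerivAt_pi.1 (hasDerivAt_pi.1 hB k) j)
  rw [Finset.sum_add_distrib] at h
  exact h

/-- The left-action momentum `M̄ = (Q̄P̄ᵀ - P̄Q̄ᵀ)/2` of the reparameterised SO(3)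
geodesic equations `Q̄' = ω̄Q̄ + Q̄ν`, `P̄' = -ω̄ᵀP̄ + P̄ν` (with `ν = θw` and `ω̄(t)`
antisymmetric) satisfies the same Euler rigid-body equation `M̄' = ω̄M̄ - M̄ω̄`
as in the unreparameterised problem: the `ν` terms cancel. -/
theorem so3_reparam_euler_poincare
    (θ : ℝ) (ν : Matrix (Fin 3) (Fin 3) ℝ) (hν : ν = θ • wz)
    (Qb Pb ωb : ℝ → Matrix (Fin 3) (Fin 3) ℝ)
    (hωb : Continuous ωb)
    (hωanti : ∀ t : ℝ, (ωb t)ᵀ = -ωb t)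
    (hQb : ∀ t : ℝ, HasDerivAt Qb (ωb t * Qb t + Qb t * ν) t)
    (hPb : ∀ t : ℝ, HasDerivAt Pb (-(ωb t)ᵀ * Pb t + Pb t * ν) t)
    (M : ℝ → Matrix (Fin 3) (Fin 3) ℝ)
    (hM : M = fun t => (2⁻¹ : ℝ) • (Qb t * (Pb t)ᵀ - Pb t * (Qb t)ᵀ)) :
    ∀ t : ℝ, HasDerivAt M (ωb t * M t - M t * ωb t) t := by
  intro t
  have hνt : νᵀ = -ν := by rw [hν, transpose_smul, wz_transpose, smul_neg]
  have hQ := hQb t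
  have hP := hPb t
  have h := ((hQ.matrix_mul hP.matrix_transpose).sub
    (hP.matrix_mul hQ.matrix_transpose)).const_smul (2⁻¹ : ℝ)
  subst hM
  refine h.congr_deriv ?_
  simp only [transpose_add, transpose_mul, hωanti, hνt, neg_neg, mul_smul_comm,
    smul_mul_assoc, ← smul_sub]
  congr 1
  noncomm_ring
end

section
/- Let n ∈ ℕ and fix matrices ν, w ∈ Mₙ(ℝ) with ν antisymmetric (νᵀ = −ν) and ν·w = w·ν. Let Q, P, ξ : ℝ → Mₙ(ℝ) with Q and P differentiable and ξ continuous, satisfying Q′(t) = ξ(t)·Q(t) + Q(t)·ν and P′(t) = −ξ(t)ᵀ·P(t) + P(t)·ν for all t. Then t ↦ trace(P(t)ᵀ·Q(t)·w) is constant in t. -/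
open Matrix

attribute [local instance] Matrix.normedAddCommGroup Matrix.normedSpace

theorem HasDerivAt.matrix_apply {m n : Type*} [Fintype m] [Fintype n]
    {A : ℝ → Matrix m n ℝ} {A' : Matrix m n ℝ} {t : ℝ} (hA : HasDerivAt A A' t) (i : m) (j : n) :
    HasDerivAt (fun s => A s i j) (A' i j) t :=
  hasDerivAt_pi.1 (hasDerivAt_pi.1 hA i) j

theorem HasDerivAt.trace_transpose_mul_mul {m n : Type*} [Fintype m] [Fintype n]
    {A B : ℝ → Matrix m n ℝ} {A' B' : Matrix m n ℝ} {t : ℝ}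
    (hA : HasDerivAt A A' t) (hB : HasDerivAt B B' t) (C : Matrix n n ℝ) :
    HasDerivAt (fun s => ((A s)ᵀ * B s * C).trace)
      ((A'ᵀ * B t + (A t)ᵀ * B') * C).trace t := by
  simp only [Matrix.trace, Matrix.diag_apply, Matrix.mul_apply, Matrix.add_apply,
    Matrix.transpose_apply, ← Finset.sum_add_distrib]
  exact HasDerivAt.fun_sum fun i _ => HasDerivAt.fun_sum fun k _ =>
    (HasDerivAt.fun_sum fun j _ =>
      (hA.matrix_apply j i).mul (hB.matrix_apply j k)).mul_const (C k i)

/-- Noether's theorem for the reparameterised geodesic problem, realised for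
matrix groups: if `Q' = ξQ + Qν` and `P' = -ξᵀP + Pν` with `ν` antisymmetric
and `νw = wν`, then the right-action momentum component `trace(PᵀQw)` is
constant in time. -/
theorem matrix_reparam_noether
    (n : ℕ) (ν w : Matrix (Fin n) (Fin n) ℝ)
    (hνanti : νᵀ = -ν) (hνw : ν * w = w * ν)
    (Q P ξ : ℝ → Matrix (Fin n) (Fin n) ℝ)
    (hξ : Continuous ξ)
    (hQ : ∀ t : ℝ, HasDerivAt Q (ξ t * Q t + Q t * ν) t)
    (hP : ∀ t : ℝ, HasDerivAt P (-(ξ t)ᵀ * P t + P t * ν) t) :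
    ∀ t : ℝ, ((P t)ᵀ * Q t * w).trace = ((P 0)ᵀ * Q 0 * w).trace := by
  have hderiv (t : ℝ) : HasDerivAt (fun s => ((P s)ᵀ * Q s * w).trace) 0 t := by
    convert (hP t).trace_transpose_mul_mul (hQ t) w using 1
    have hcyc : (ν * ((P t)ᵀ * Q t * w)).trace = ((P t)ᵀ * Q t * (ν * w)).trace := by
      rw [Matrix.trace_mul_comm, hνw, Matrix.mul_assoc _ w ν]
    have hexpand : ((-(ξ t)ᵀ * P t + P t * ν)ᵀ * Q t + (P t)ᵀ * (ξ t * Q t + Q t * ν)) * w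
        = (P t)ᵀ * Q t * (ν * w) - ν * ((P t)ᵀ * Q t * w) := by
      simp only [Matrix.transpose_add, Matrix.transpose_mul, Matrix.transpose_neg,
        Matrix.transpose_transpose, hνanti]
      noncomm_ring
    rw [hexpand, Matrix.trace_sub, hcyc, sub_self]
  intro t
  exact is_const_of_deriv_eq_zero (fun s => (hderiv s).differentiableAt)
    (fun s => (hderiv s).deriv) t 0
end

section
/- Let u : ℝ² × ℝ → ℝ² be a time-dependent vector field, differentiable in its first (spatial) argument, and let q, p : ℝ × ℝ → ℝ² be maps (s, t) ↦ q(s,t), p(s,t), with q twice continuously differentiable (so that ∂ₜ∂ₛq = ∂ₛ∂ₜq) and p differentiable in t with ∂ₛq, ∂ₜp continuous, satisfying for all (s,t): ∂ₜq(s,t) = u(q(s,t), t) and ∂ₜp(s,t) = −(Dₓu(q(s,t), t))ᵀ (p(s,t)). Then for every s, the tangential momentum t ↦ ⟨p(s,t), ∂ₛq(s,t)⟩ is constant in t. -/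
open scoped RealInnerProductSpace

section PartialDerivatives

variable {E : Type*} [NormedAddCommGroup E] [NormedSpace ℝ E]

theorem HasFDerivAt.hasDerivAt_partial_fst {f : ℝ × ℝ → E} {f' : ℝ × ℝ →L[ℝ] E} {s t : ℝ}
    (hf : HasFDerivAt f f' (s, t)) : HasDerivAt (fun σ => f (σ, t)) (f' (1, 0)) s :=
  hf.comp_hasDerivAt s ((hasDerivAt_id s).prodMk (hasDerivAt_const s t))

theorem HasFDerivAt.hasDerivAt_partial_snd {f : ℝ × ℝ → E} {f' : ℝ × ℝ →L[ℝ] E} {s t : ℝ}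
    (hf : HasFDerivAt f f' (s, t)) : HasDerivAt (fun τ => f (s, τ)) (f' (0, 1)) t :=
  hf.comp_hasDerivAt t ((hasDerivAt_const t s).prodMk (hasDerivAt_id t))

/-- Partial derivatives of a `C²` function on the plane commute. -/
theorem ContDiff.hasDerivAt_deriv_partial_comm {f : ℝ × ℝ → E} (hf : ContDiff ℝ 2 f) (s t : ℝ) :
    HasDerivAt (fun τ => deriv (fun σ => f (σ, τ)) s)
      (deriv (fun σ => deriv (fun τ => f (σ, τ)) t) s) t := by
  have hf₁ (x : ℝ × ℝ) : HasFDerivAt f (fderiv ℝ f x) x :=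
    (hf.differentiable two_ne_zero x).hasFDerivAt
  have hf₂ : HasFDerivAt (fderiv ℝ f) (fderiv ℝ (fderiv ℝ f) (s, t)) (s, t) :=
    ((hf.fderiv_right (m := 1) (by norm_num)).differentiable one_ne_zero _).hasFDerivAt
  have hsymm : IsSymmSndFDerivAt ℝ f (s, t) := hf.contDiffAt.isSymmSndFDerivAt (by simp)
  have hfst : ∀ τ, deriv (fun σ => f (σ, τ)) s = fderiv ℝ f (s, τ) (1, 0) :=
    fun τ => (hf₁ (s, τ)).hasDerivAt_partial_fst.deriv
  have hsnd : ∀ σ, deriv (fun τ => f (σ, τ)) t = fderiv ℝ f (σ, t) (0, 1) :=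
    fun σ => (hf₁ (σ, t)).hasDerivAt_partial_snd.deriv
  simp only [hfst, hsnd]
  have hs := hf₂.hasDerivAt_partial_fst.clm_apply (hasDerivAt_const s ((0, 1) : ℝ × ℝ))
  have ht := hf₂.hasDerivAt_partial_snd.clm_apply (hasDerivAt_const t ((1, 0) : ℝ × ℝ))
  rw [hs.deriv]
  simpa [hsymm.eq (0, 1) (1, 0)] using ht

end PartialDerivatives

/-- Noether's theorem for the curve matching problem: along the geodesic
equations `∂ₜq = u(q,t)`, `∂ₜp = -(Dₓu(q,t))ᵀ p` for a parameterised plane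
curve, the tangential momentum `⟨p(s,t), ∂ₛq(s,t)⟩` is constant in `t` for
every `s`. -/
theorem curve_matching_noether
    (u : EuclideanSpace ℝ (Fin 2) → ℝ → EuclideanSpace ℝ (Fin 2))
    (q p : ℝ × ℝ → EuclideanSpace ℝ (Fin 2))
    (hu : ∀ t : ℝ, Differentiable ℝ fun x => u x t)
    (hq : ContDiff ℝ 2 q)
    (hqt : ∀ s t : ℝ, HasDerivAt (fun τ => q (s, τ)) (u (q (s, t)) t) t)
    (hpt : ∀ s t : ℝ, HasDerivAt (fun τ => p (s, τ))
      (-(ContinuousLinearMap.adjoint (fderiv ℝ (fun x => u x t) (q (s, t)))) (p (s, t))) t)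
    (hqs_cont : Continuous fun st : ℝ × ℝ => deriv (fun σ => q (σ, st.2)) st.1)
    (hpt_cont : Continuous fun st : ℝ × ℝ =>
      (ContinuousLinearMap.adjoint (fderiv ℝ (fun x => u x st.2) (q st))) (p st)) :
    ∀ s t : ℝ,
      ⟪p (s, t), deriv (fun σ => q (σ, t)) s⟫
        = ⟪p (s, 0), deriv (fun σ => q (σ, 0)) s⟫ := by
  intro s t
  have hderiv (τ : ℝ) :
      HasDerivAt (fun τ => ⟪p (s, τ), deriv (fun σ => q (σ, τ)) s⟫) 0 τ := by
    have hqs : HasDerivAt (fun σ => q (σ, τ)) (deriv (fun σ => q (σ, τ)) s) s :=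
      (hq.differentiable two_ne_zero
        (s, τ)).hasFDerivAt.hasDerivAt_partial_fst.differentiableAt.hasDerivAt
    have hmixed := hq.hasDerivAt_deriv_partial_comm s τ
    simp only [fun σ => (hqt σ τ).deriv] at hmixed
    have hchain : HasDerivAt (fun σ => u (q (σ, τ)) τ)
        (fderiv ℝ (fun x => u x τ) (q (s, τ)) (deriv (fun σ => q (σ, τ)) s)) s :=
      HasFDerivAt.comp_hasDerivAt (l := fun x => u x τ) s (hu τ (q (s, τ))).hasFDerivAt hqs
    rw [hchain.deriv] at hmixed
    have hinner := (hpt s τ).inner ℝ hmixed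
    rwa [inner_neg_left, ContinuousLinearMap.adjoint_inner_left, add_neg_cancel] at hinner
  exact is_const_of_deriv_eq_zero (fun τ => (hderiv τ).differentiableAt)
    (fun τ => (hderiv τ).deriv) t 0
end

section
/- Let u : ℝ² × ℝ → ℝ² be differentiable in its first (spatial) argument, and let q, p : ℝ × ℝ → ℝ² with q twice continuously differentiable and p differentiable in t with ∂ₛq, ∂ₜp continuous, satisfying for all (s,t): ∂ₜq(s,t) = u(q(s,t), t) and ∂ₜp(s,t) = −(Dₓu(q(s,t), t))ᵀ (p(s,t)). If the endpoint condition ⟨p(s,1), ∂ₛq(s,1)⟩ = 0 holds for all s ∈ ℝ, then ⟨p(s,t), ∂ₛq(s,t)⟩ = 0 for all s ∈ ℝ and all t; that is, the momentum p(s,t) is normal to the curve q(·,t) at every point and every time. -/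
open scoped RealInnerProductSpace

/-- Mixed partial derivatives: for a `C²` map on the plane, the `t`-derivative of `∂ₛf` is
the `s`-derivative of `∂ₜf`. -/
theorem ContDiff.hasDerivAt_deriv_fst_of_hasDerivAt_snd
    {E : Type*} [NormedAddCommGroup E] [NormedSpace ℝ E] {f g : ℝ × ℝ → E}
    (hf : ContDiff ℝ 2 f) (hg : ∀ s t : ℝ, HasDerivAt (fun τ => f (s, τ)) (g (s, t)) t)
    {s t : ℝ} {v : E} (hv : HasDerivAt (fun σ => g (σ, t)) v s) :
    HasDerivAt (fun τ => deriv (fun σ => f (σ, τ)) s) v t := by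
  have hd : Differentiable ℝ f := hf.differentiable (by norm_num)
  have hd' : Differentiable ℝ (fderiv ℝ f) :=
    (hf.fderiv_right (m := 1) (by norm_num)).differentiable (by norm_num)
  have line_fst (a b : ℝ) : HasDerivAt (fun σ : ℝ => (σ, b)) ((1 : ℝ), (0 : ℝ)) a :=
    (hasDerivAt_id a).prodMk (hasDerivAt_const a b)
  have line_snd (a b : ℝ) : HasDerivAt (fun τ : ℝ => (a, τ)) ((0 : ℝ), (1 : ℝ)) b :=
    (hasDerivAt_const b a).prodMk (hasDerivAt_id b)
  have partial_fst (τ : ℝ) : deriv (fun σ => f (σ, τ)) s = fderiv ℝ f (s, τ) (1, 0) :=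
    ((hd (s, τ)).hasFDerivAt.comp_hasDerivAt s (line_fst s τ)).deriv
  have partial_snd (σ : ℝ) : g (σ, t) = fderiv ℝ f (σ, t) (0, 1) :=
    (hg σ t).unique ((hd (σ, t)).hasFDerivAt.comp_hasDerivAt t (line_snd σ t))
  have mixed_ts : HasDerivAt (fun τ => fderiv ℝ f (s, τ) (1, 0))
      (fderiv ℝ (fderiv ℝ f) (s, t) (0, 1) (1, 0)) t := by
    exact (ContinuousLinearMap.apply ℝ E ((1 : ℝ), (0 : ℝ))).hasFDerivAt.comp_hasDerivAt t
      ((hd' (s, t)).hasFDerivAt.comp_hasDerivAt t (line_snd s t))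
  have mixed_st : HasDerivAt (fun σ => fderiv ℝ f (σ, t) (0, 1))
      (fderiv ℝ (fderiv ℝ f) (s, t) (1, 0) (0, 1)) s := by
    exact (ContinuousLinearMap.apply ℝ E ((0 : ℝ), (1 : ℝ))).hasFDerivAt.comp_hasDerivAt s
      ((hd' (s, t)).hasFDerivAt.comp_hasDerivAt s (line_fst s t))
  have symm : IsSymmSndFDerivAt ℝ f (s, t) :=
    hf.contDiffAt.isSymmSndFDerivAt (by simp)
  simp_rw [partial_snd] at hv
  simp_rw [partial_fst]
  rw [hv.unique mixed_st, symm.eq]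
  exact mixed_ts

/-- Vanishing momentum for curve matching: along the geodesic equations
`∂ₜq = u(q,t)`, `∂ₜp = -(Dₓu(q,t))ᵀ p`, if the tangential momentum
`⟨p(s,1), ∂ₛq(s,1)⟩` vanishes at the endpoint `t = 1` for all `s`, then
`⟨p(s,t), ∂ₛq(s,t)⟩ = 0` for all `s` and all `t`: the momentum is everywhere
normal to the evolving curve. -/
theorem curve_matching_vanishing_momentum
    (u : EuclideanSpace ℝ (Fin 2) → ℝ → EuclideanSpace ℝ (Fin 2))
    (q p : ℝ × ℝ → EuclideanSpace ℝ (Fin 2))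
    (hu : ∀ t : ℝ, Differentiable ℝ fun x => u x t)
    (hq : ContDiff ℝ 2 q)
    (hqt : ∀ s t : ℝ, HasDerivAt (fun τ => q (s, τ)) (u (q (s, t)) t) t)
    (hpt : ∀ s t : ℝ, HasDerivAt (fun τ => p (s, τ))
      (-(ContinuousLinearMap.adjoint (fderiv ℝ (fun x => u x t) (q (s, t)))) (p (s, t))) t)
    (hqs_cont : Continuous fun st : ℝ × ℝ => deriv (fun σ => q (σ, st.2)) st.1)
    (hpt_cont : Continuous fun st : ℝ × ℝ =>
      (ContinuousLinearMap.adjoint (fderiv ℝ (fun x => u x st.2) (q st))) (p st))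
    (hend : ∀ s : ℝ, ⟪p (s, 1), deriv (fun σ => q (σ, 1)) s⟫ = 0) :
    ∀ s t : ℝ, ⟪p (s, t), deriv (fun σ => q (σ, t)) s⟫ = 0 := by
  intro s t
  have hqs (t : ℝ) : HasDerivAt (fun σ => q (σ, t)) (deriv (fun σ => q (σ, t)) s) s := by
    have hd : Differentiable ℝ q := hq.differentiable (by norm_num)
    exact (show DifferentiableAt ℝ (fun σ => q (σ, t)) s by fun_prop).hasDerivAt
  have hqst (t : ℝ) : HasDerivAt (fun τ => deriv (fun σ => q (σ, τ)) s)
      (fderiv ℝ (fun x => u x t) (q (s, t)) (deriv (fun σ => q (σ, t)) s)) t :=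
    hq.hasDerivAt_deriv_fst_of_hasDerivAt_snd (g := fun st => u (q st) st.2) hqt
      (HasFDerivAt.comp_hasDerivAt (l := fun x => u x t) s
        (hu t (q (s, t))).hasFDerivAt (hqs t))
  have hconst (t : ℝ) : HasDerivAt
      (fun τ => ⟪p (s, τ), deriv (fun σ => q (σ, τ)) s⟫) 0 t := by
    refine ((hpt s t).inner ℝ (hqst t)).congr_deriv ?_
    rw [inner_neg_left, ContinuousLinearMap.adjoint_inner_left, add_neg_cancel]
  rw [← hend s]
  exact is_const_of_deriv_eq_zero (fun τ => (hconst τ).differentiableAt)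
    (fun τ => (hconst τ).deriv) t 1
end

section
/- Let u : ℝ² × ℝ → ℝ² be continuous, let ν : ℝ → ℝ be continuously differentiable, and let ψ : ℝ × ℝ → ℝ be differentiable with ∂ₜψ(s,t) = ν(ψ(s,t)), ψ(s,0) = s, and satisfying the flow identity ν(ψ(s,t)) = ν(s)·∂ₛψ(s,t) for all (s,t). Let q̄ : ℝ × ℝ → ℝ² be differentiable and satisfy the reparameterised curve equation ∂ₜq̄(s,t) = u(q̄(s,t), t) + ν(s)·∂ₛq̄(s,t) for all (s,t). Let q : ℝ × ℝ → ℝ² be continuously differentiable (jointly in (x,t)) with q(ψ(s,t), t) = q̄(s,t) for all (s,t). Then for all (s,t), the partial time derivative of q at fixed spatial argument satisfies (∂ₜq)(ψ(s,t), t) = u(q(ψ(s,t), t), t); that is, q satisfies the unreparameterised curve equation ∂ₜq = u(q,t) along the flow. -/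
/-- The `q`-component of the equivalence theorem for curve matching: if `q̄`
solves the reparameterised curve equation `∂ₜq̄ = u(q̄,t) + ν(s)·∂ₛq̄`, `ψ` is
the flow of `ν` (satisfying the flow identity `ν(ψ(s,t)) = ν(s)·∂ₛψ(s,t)`),
and `q` is a C¹ map with `q(ψ(s,t),t) = q̄(s,t)`, then `q` satisfies the
unreparameterised curve equation `∂ₜq = u(q,t)` along the flow. -/
theorem curve_reparam_equivalence_q
    (u : EuclideanSpace ℝ (Fin 2) → ℝ → EuclideanSpace ℝ (Fin 2))
    (hu : Continuous fun xt : EuclideanSpace ℝ (Fin 2) × ℝ => u xt.1 xt.2)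
    (ν : ℝ → ℝ) (hν : ContDiff ℝ 1 ν)
    (ψ : ℝ × ℝ → ℝ) (hψ : Differentiable ℝ ψ)
    (hψt : ∀ s t : ℝ, HasDerivAt (fun τ => ψ (s, τ)) (ν (ψ (s, t))) t)
    (hψ0 : ∀ s : ℝ, ψ (s, 0) = s)
    (hflow : ∀ s t : ℝ, ν (ψ (s, t)) = ν s * deriv (fun σ => ψ (σ, t)) s)
    (qb : ℝ × ℝ → EuclideanSpace ℝ (Fin 2)) (hqb : Differentiable ℝ qb)
    (hqbt : ∀ s t : ℝ, HasDerivAt (fun τ => qb (s, τ))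
      (u (qb (s, t)) t + ν s • deriv (fun σ => qb (σ, t)) s) t)
    (q : ℝ × ℝ → EuclideanSpace ℝ (Fin 2)) (hq : ContDiff ℝ 1 q)
    (hrel : ∀ s t : ℝ, q (ψ (s, t), t) = qb (s, t)) :
    ∀ s t : ℝ, deriv (fun τ => q (ψ (s, t), τ)) t = u (q (ψ (s, t), t)) t := by
  intro s t
  have hL : HasFDerivAt q (fderiv ℝ q (ψ (s, t), t)) (ψ (s, t), t) :=
    (hq.differentiable one_ne_zero _).hasFDerivAt
  set L := fderiv ℝ q (ψ (s, t), t)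
  have hψs : HasDerivAt (fun σ => ψ (σ, t)) (deriv (fun σ => ψ (σ, t)) s) s :=
    DifferentiableAt.hasDerivAt (by fun_prop)
  have along_time : HasDerivAt (fun τ => qb (s, τ)) (L (ν (ψ (s, t)), 1)) t := by
    simp only [← hrel]
    exact hL.comp_hasDerivAt (f := fun τ => (ψ (s, τ), τ)) t
      ((hψt s t).prodMk (hasDerivAt_id t))
  have along_space : HasDerivAt (fun σ => qb (σ, t))
      (L (deriv (fun σ => ψ (σ, t)) s, 0)) s := by
    simp only [← hrel]
    exact hL.comp_hasDerivAt (f := fun σ => (ψ (σ, t), t)) s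
      (hψs.prodMk (hasDerivAt_const s t))
  have fixed_space : HasDerivAt (fun τ => q (ψ (s, t), τ)) (L (0, 1)) t :=
    hL.comp_hasDerivAt t ((hasDerivAt_const t (ψ (s, t))).prodMk (hasDerivAt_id t))
  have key := along_time.unique (hqbt s t)
  have split : ((ν (ψ (s, t)), 1) : ℝ × ℝ) =
      (0, 1) + ν s • (deriv (fun σ => ψ (σ, t)) s, 0) := by
    simp [hflow s t]
  rw [along_space.deriv, split, map_add, map_smul] at key
  rw [fixed_space.deriv, hrel]
  exact add_right_cancel key
end

section
/- Let u : ℝ² × ℝ → ℝ² be differentiable in its first (spatial) argument, ν : ℝ → ℝ continuously differentiable, and ψ : ℝ × ℝ → ℝ twice continuously differentiable with ∂ₜψ(s,t) = ν(ψ(s,t)), ψ(s,0) = s, and satisfying the flow identity ν(ψ(s,t)) = ν(s)·∂ₛψ(s,t) for all (s,t). Let q̄, p̄ : ℝ × ℝ → ℝ² be sufficiently smooth and satisfy the reparameterised curve equations ∂ₜq̄(s,t) = u(q̄(s,t),t) + ν(s)·∂ₛq̄(s,t) and ∂ₜp̄(s,t) = −(Dₓu(q̄(s,t),t))ᵀ(p̄(s,t))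 + ∂ₛ(ν(s)·p̄(s,t)). Let q, p : ℝ × ℝ → ℝ² be continuously differentiable (jointly) with q(ψ(s,t), t) = q̄(s,t) and ∂ₛψ(s,t)·p(ψ(s,t), t) = p̄(s,t) for all (s,t), and assume p is differentiable in its spatial argument. Then for all (s,t): (∂ₜp)(ψ(s,t), t) = −(Dₓu(q(ψ(s,t),t), t))ᵀ (p(ψ(s,t), t)); that is, the transformed momentum satisfies the unreparameterised momentum equation ∂ₜp = −(Dₓu(q,t))ᵀp along the flow. -/
theorem HasFDerivAt.hasDerivAt_partial_left {E : Type*} [NormedAddCommGroup E] [NormedSpace ℝ E]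
    {f : ℝ × ℝ → E} {f' : ℝ × ℝ →L[ℝ] E} {s t : ℝ} (h : HasFDerivAt f f' (s, t)) :
    HasDerivAt (fun σ => f (σ, t)) (f' (1, 0)) s :=
  h.comp_hasDerivAt s ((hasDerivAt_id s).prodMk (hasDerivAt_const s t))

theorem HasFDerivAt.hasDerivAt_partial_right {E : Type*} [NormedAddCommGroup E] [NormedSpace ℝ E]
    {f : ℝ × ℝ → E} {f' : ℝ × ℝ →L[ℝ] E} {s t : ℝ} (h : HasFDerivAt f f' (s, t)) :
    HasDerivAt (fun τ => f (s, τ)) (f' (0, 1)) t :=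
  h.comp_hasDerivAt t ((hasDerivAt_const t s).prodMk (hasDerivAt_id t))

/-- The spatial derivative of a flow satisfies the variational equation. -/
theorem hasDerivAt_deriv_flow {ν : ℝ → ℝ} (hν : Differentiable ℝ ν)
    {ψ : ℝ × ℝ → ℝ} (hψ : ContDiff ℝ 2 ψ)
    (hψt : ∀ s t : ℝ, HasDerivAt (fun τ => ψ (s, τ)) (ν (ψ (s, t))) t) (s t : ℝ) :
    HasDerivAt (fun τ => deriv (fun σ => ψ (σ, τ)) s)
      (deriv ν (ψ (s, t)) * deriv (fun σ => ψ (σ, t)) s) t := by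
  have hd : ∀ z, HasFDerivAt ψ (fderiv ℝ ψ z) z := fun z =>
    (hψ.differentiable (by norm_num) z).hasFDerivAt
  have hd2 : HasFDerivAt (fderiv ℝ ψ) (fderiv ℝ (fderiv ℝ ψ) (s, t)) (s, t) :=
    ((hψ.fderiv_right (m := 1) (by norm_num)).differentiable (by norm_num) _).hasFDerivAt
  have hL : ∀ τ, deriv (fun σ => ψ (σ, τ)) s = fderiv ℝ ψ (s, τ) (1, 0) := fun τ =>
    (hd (s, τ)).hasDerivAt_partial_left.deriv
  have hR : ∀ σ, fderiv ℝ ψ (σ, t) (0, 1) = ν (ψ (σ, t)) := fun σ =>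
    (hd (σ, t)).hasDerivAt_partial_right.unique (hψt σ t)
  have hsymm := second_derivative_symmetric hd hd2 (0, 1) (1, 0)
  have h₁ := hd2.hasDerivAt_partial_right.clm_apply (hasDerivAt_const t ((1, 0) : ℝ × ℝ))
  have h₂ := hd2.hasDerivAt_partial_left.clm_apply (hasDerivAt_const s ((0, 1) : ℝ × ℝ))
  have h₃ := (hν (ψ (s, t))).hasDerivAt.comp s (hd (s, t)).hasDerivAt_partial_left
  simp only [map_zero, add_zero] at h₁ h₂
  have h₄ := (h₂.congr_of_eventuallyEq (.of_forall fun σ => (hR σ).symm)).unique h₃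
  simp only [hL]
  rw [← h₄, ← hsymm]
  exact h₁

/-- A solution of a scalar linear homogeneous differential equation with continuous coefficient
that is nonzero at one time never vanishes. -/
theorem ne_zero_of_hasDerivAt_mul_self {a c : ℝ → ℝ} (hc : Continuous c)
    (ha : ∀ t, HasDerivAt a (c t * a t) t) {t₀ : ℝ} (h₀ : a t₀ ≠ 0) (t : ℝ) : a t ≠ 0 := by
  have hE : ∀ τ, HasDerivAt (fun r => a r * Real.exp (-∫ x in t₀..r, c x)) 0 τ := fun τ => by
    refine ((ha τ).mul ((hc.integral_hasStrictDerivAt t₀ τ).hasDerivAt.neg.exp)).congr_deriv ?_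
    ring
  have h := is_const_of_deriv_eq_zero (fun τ => (hE τ).differentiableAt) (fun τ => (hE τ).deriv)
    t t₀
  intro hat
  simp [hat] at h
  exact h₀ h.symm

/-- The `p`-component of the equivalence theorem for curve matching: if
`(q̄, p̄)` solves the reparameterised curve matching equations
`∂ₜq̄ = u(q̄,t) + ν(s)·∂ₛq̄`, `∂ₜp̄ = -(Dₓu(q̄,t))ᵀ p̄ + ∂ₛ(ν(s)·p̄)`, `ψ` is the
flow of `ν` (satisfying the flow identity), and `(q, p)` are C¹ maps with
`q(ψ(s,t),t) = q̄(s,t)` and `∂ₛψ(s,t)·p(ψ(s,t),t) = p̄(s,t)` (the cotangent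
lift), then `p` satisfies the unreparameterised momentum equation
`∂ₜp = -(Dₓu(q,t))ᵀ p` along the flow. -/
theorem curve_reparam_equivalence_p
    (u : EuclideanSpace ℝ (Fin 2) → ℝ → EuclideanSpace ℝ (Fin 2))
    (hu : ∀ t : ℝ, Differentiable ℝ fun x => u x t)
    (ν : ℝ → ℝ) (hν : ContDiff ℝ 1 ν)
    (ψ : ℝ × ℝ → ℝ) (hψ : ContDiff ℝ 2 ψ)
    (hψt : ∀ s t : ℝ, HasDerivAt (fun τ => ψ (s, τ)) (ν (ψ (s, t))) t)
    (hψ0 : ∀ s : ℝ, ψ (s, 0) = s)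
    (hflow : ∀ s t : ℝ, ν (ψ (s, t)) = ν s * deriv (fun σ => ψ (σ, t)) s)
    (qb pb : ℝ × ℝ → EuclideanSpace ℝ (Fin 2))
    (hqb : ContDiff ℝ 2 qb) (hpb : ContDiff ℝ 2 pb)
    (hqbt : ∀ s t : ℝ, HasDerivAt (fun τ => qb (s, τ))
      (u (qb (s, t)) t + ν s • deriv (fun σ => qb (σ, t)) s) t)
    (hpbt : ∀ s t : ℝ, HasDerivAt (fun τ => pb (s, τ))
      (-(ContinuousLinearMap.adjoint (fderiv ℝ (fun x => u x t) (qb (s, t)))) (pb (s, t))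
        + (deriv ν s • pb (s, t) + ν s • deriv (fun σ => pb (σ, t)) s)) t)
    (q p : ℝ × ℝ → EuclideanSpace ℝ (Fin 2))
    (hq : ContDiff ℝ 1 q) (hp : ContDiff ℝ 1 p)
    (hps : ∀ t : ℝ, Differentiable ℝ fun x => p (x, t))
    (hqrel : ∀ s t : ℝ, q (ψ (s, t), t) = qb (s, t))
    (hprel : ∀ s t : ℝ, deriv (fun σ => ψ (σ, t)) s • p (ψ (s, t), t) = pb (s, t)) :
    ∀ s t : ℝ, deriv (fun τ => p (ψ (s, t), τ)) t
      = -(ContinuousLinearMap.adjoint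
          (fderiv ℝ (fun x => u x t) (q (ψ (s, t), t)))) (p (ψ (s, t), t)) := by
  intro s t
  have hνd : Differentiable ℝ ν := hν.differentiable (by norm_num)
  have ha := hasDerivAt_deriv_flow hνd hψ hψt
  have hd : HasFDerivAt ψ (fderiv ℝ ψ (s, t)) (s, t) :=
    (hψ.differentiable (by norm_num) _).hasFDerivAt
  have hψs : HasDerivAt (fun σ => ψ (σ, t)) (deriv (fun σ => ψ (σ, t)) s) s :=
    hd.hasDerivAt_partial_left.differentiableAt.hasDerivAt
  have hne : deriv (fun σ => ψ (σ, t)) s ≠ 0 := by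
    refine ne_zero_of_hasDerivAt_mul_self (c := fun τ => deriv ν (ψ (s, τ)))
      (a := fun τ => deriv (fun σ => ψ (σ, τ)) s) (t₀ := 0) ?_ (ha s) (by simp [hψ0]) t
    exact (hν.continuous_deriv le_rfl).comp (hψ.continuous.comp (by fun_prop))
  have has : DifferentiableAt ℝ (fun σ => deriv (fun x => ψ (x, t)) σ) s := by
    have h : ContDiff ℝ 2 fun σ => ψ (σ, t) := hψ.comp (by fun_prop)
    exact (h.differentiable_deriv_two) s
  have hνa := (hνd s).hasDerivAt.mul has.hasDerivAt
  have hνψ := (hνd (ψ (s, t))).hasDerivAt.comp s hψs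
  have hflow' := (hνa.congr_of_eventuallyEq (.of_forall fun σ => hflow σ t)).unique hνψ
  have hpd : HasFDerivAt p (fderiv ℝ p (ψ (s, t), t)) (ψ (s, t), t) :=
    (hp.differentiable (by norm_num) _).hasFDerivAt
  have hpx := hpd.hasDerivAt_partial_left
  have hpt := hpd.hasDerivAt_partial_right
  have hpψs := hpx.scomp s hψs
  have hpψt : HasDerivAt (fun τ => p (ψ (s, τ), τ))
      (fderiv ℝ p (ψ (s, t), t) (ν (ψ (s, t)), 1)) t :=
    HasFDerivAt.comp_hasDerivAt (f := fun τ => (ψ (s, τ), τ)) t hpd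
      ((hψt s t).prodMk (hasDerivAt_id t))
  have hsplit : fderiv ℝ p (ψ (s, t), t) (ν (ψ (s, t)), 1) =
      ν (ψ (s, t)) • fderiv ℝ p (ψ (s, t), t) (1, 0) + fderiv ℝ p (ψ (s, t), t) (0, 1) := by
    rw [← map_smul, ← map_add]
    simp
  have hpbs := ((has.hasDerivAt.smul hpψs).congr_of_eventuallyEq
    (.of_forall fun σ => (hprel σ t).symm)).deriv
  have hpbt' := (((ha s t).smul hpψt).congr_of_eventuallyEq
    (.of_forall fun τ => (hprel s τ).symm)).unique (hpbt s t)
  rw [hpbs, hsplit, ← hprel s t, ← hqrel s t, map_smul] at hpbt'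
  rw [hpt.deriv]
  refine smul_right_injective _ hne ?_
  simp only [Function.comp_apply] at hpbt' hflow' ⊢
  rw [← hflow', hflow s t] at hpbt'
  rw [← sub_eq_zero] at hpbt' ⊢
  rw [← hpbt']
  module
end

section
/- Let u : ℝ² × ℝ → ℝ² be differentiable in its first (spatial) argument, ν : ℝ → ℝ continuously differentiable, and let q̄, p̄ : ℝ × ℝ → ℝ² be twice continuously differentiable, satisfying for all (s,t): ∂ₜq̄(s,t) = u(q̄(s,t),t) + ν(s)·∂ₛq̄(s,t) and ∂ₜp̄(s,t) = −(Dₓu(q̄(s,t),t))ᵀ(p̄(s,t)) + ∂ₛ(ν(s)·p̄(s,t)). Then the tangential momentum density f(s,t) := ⟨p̄(s,t), ∂ₛq̄(s,t)⟩ satisfies the linear transport-type equation ∂ₜf(s,t) = 2ν′(s)·f(s,t) + ν(s)·∂ₛf(s,t) for all (s,t). In particular, the terms involving u and its derivative cancel identically. -/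
open scoped RealInnerProductSpace

/-- Chain rule along a horizontal line in the plane. -/
theorem DifferentiableAt.hasDerivAt_fst_slice {E : Type*} [NormedAddCommGroup E] [NormedSpace ℝ E]
    {f : ℝ × ℝ → E} {s t : ℝ} (hf : DifferentiableAt ℝ f (s, t)) :
    HasDerivAt (fun σ => f (σ, t)) (fderiv ℝ f (s, t) (1, 0)) s :=
  HasFDerivAt.comp_hasDerivAt (f := fun σ : ℝ => (σ, t)) s hf.hasFDerivAt
    ((hasDerivAt_id s).prodMk (hasDerivAt_const s t))

/-- Chain rule along a vertical line in the plane. -/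
theorem DifferentiableAt.hasDerivAt_snd_slice {E : Type*} [NormedAddCommGroup E] [NormedSpace ℝ E]
    {f : ℝ × ℝ → E} {s t : ℝ} (hf : DifferentiableAt ℝ f (s, t)) :
    HasDerivAt (fun τ => f (s, τ)) (fderiv ℝ f (s, t) (0, 1)) t :=
  HasFDerivAt.comp_hasDerivAt (f := fun τ : ℝ => (s, τ)) t hf.hasFDerivAt
    ((hasDerivAt_const t s).prodMk (hasDerivAt_id t))

/-- Mixed second derivatives of a `C²` map commute. -/
theorem ContDiff.fderiv_fderiv_apply_comm {F E : Type*} [NormedAddCommGroup F] [NormedSpace ℝ F]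
    [NormedAddCommGroup E] [NormedSpace ℝ E] {f : F → E} (hf : ContDiff ℝ 2 f) (z v w : F) :
    fderiv ℝ (fun y => fderiv ℝ f y v) z w = fderiv ℝ (fun y => fderiv ℝ f y w) z v := by
  have hd : DifferentiableAt ℝ (fderiv ℝ f) z :=
    (hf.fderiv_right (m := 1) (by norm_num)).differentiable (by norm_num) z
  rw [fderiv_clm_apply hd (differentiableAt_const v), fderiv_clm_apply hd (differentiableAt_const w)]
  simpa using hf.contDiffAt.isSymmSndFDerivAt (by simp) w v

/-- Noether's theorem for the reparameterised curve matching problem, in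
pointwise form: along the reparameterised curve matching equations
`∂ₜq̄ = u(q̄,t) + ν(s)·∂ₛq̄`, `∂ₜp̄ = -(Dₓu(q̄,t))ᵀ p̄ + ∂ₛ(ν(s)·p̄)`, the
tangential momentum density `f(s,t) = ⟨p̄(s,t), ∂ₛq̄(s,t)⟩` satisfies the
linear transport-type equation `∂ₜf = 2ν′(s)·f + ν(s)·∂ₛf`; in particular all
terms involving `u` and its derivative cancel. -/
theorem curve_reparam_tangential_momentum_transport
    (u : EuclideanSpace ℝ (Fin 2) → ℝ → EuclideanSpace ℝ (Fin 2))
    (hu : ∀ t : ℝ, Differentiable ℝ fun x => u x t)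
    (ν : ℝ → ℝ) (hν : ContDiff ℝ 1 ν)
    (qb pb : ℝ × ℝ → EuclideanSpace ℝ (Fin 2))
    (hqb : ContDiff ℝ 2 qb) (hpb : ContDiff ℝ 2 pb)
    (hqbt : ∀ s t : ℝ, HasDerivAt (fun τ => qb (s, τ))
      (u (qb (s, t)) t + ν s • deriv (fun σ => qb (σ, t)) s) t)
    (hpbt : ∀ s t : ℝ, HasDerivAt (fun τ => pb (s, τ))
      (-(ContinuousLinearMap.adjoint (fderiv ℝ (fun x => u x t) (qb (s, t)))) (pb (s, t))
        + (deriv ν s • pb (s, t) + ν s • deriv (fun σ => pb (σ, t)) s)) t) :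
    ∀ s t : ℝ, HasDerivAt
      (fun τ => ⟪pb (s, τ), deriv (fun σ => qb (σ, τ)) s⟫)
      (2 * deriv ν s * ⟪pb (s, t), deriv (fun σ => qb (σ, t)) s⟫
        + ν s * deriv (fun σ' => ⟪pb (σ', t), deriv (fun σ => qb (σ, t)) σ'⟫) s)
      t := by
  intro s t
  have hq : Differentiable ℝ qb := hqb.differentiable (by norm_num)
  have hp : Differentiable ℝ pb := hpb.differentiable (by norm_num)
  have hdq (v : ℝ × ℝ) : Differentiable ℝ (fun z => fderiv ℝ qb z v) :=
    ((hqb.fderiv_right (m := 1) (by norm_num)).differentiable (by norm_num)).clm_apply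
      (differentiable_const v)
  have hqs (σ τ : ℝ) : deriv (fun σ' => qb (σ', τ)) σ = fderiv ℝ qb (σ, τ) (1, 0) :=
    (hq (σ, τ)).hasDerivAt_fst_slice.deriv
  have hps : HasDerivAt (fun σ => pb (σ, t)) (fderiv ℝ pb (s, t) (1, 0)) s :=
    (hp (s, t)).hasDerivAt_fst_slice
  have hqt (σ : ℝ) :
      fderiv ℝ qb (σ, t) (0, 1) = u (qb (σ, t)) t + ν σ • fderiv ℝ qb (σ, t) (1, 0) := by
    rw [← hqs]
    exact (hq (σ, t)).hasDerivAt_snd_slice.unique (hqbt σ t)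
  have hqss := (hdq (1, 0) (s, t)).hasDerivAt_fst_slice
  have hνs : HasDerivAt ν (deriv ν s) s := (hν.differentiable (by norm_num) s).hasDerivAt
  have hus : HasDerivAt (fun σ => u (qb (σ, t)) t)
      (fderiv ℝ (fun x => u x t) (qb (s, t)) (fderiv ℝ qb (s, t) (1, 0))) s :=
    HasFDerivAt.comp_hasDerivAt (f := fun σ => qb (σ, t)) s (hu t (qb (s, t))).hasFDerivAt
      (hq (s, t)).hasDerivAt_fst_slice
  have hqts := (hdq (0, 1) (s, t)).hasDerivAt_fst_slice
  simp only [hqt] at hqts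
  have hmixed := hqts.unique (hus.add (hνs.smul hqss))
  have hqst := (hdq (1, 0) (s, t)).hasDerivAt_snd_slice
  rw [hqb.fderiv_fderiv_apply_comm, hmixed] at hqst
  have hpt := hpbt s t
  rw [hps.deriv] at hpt
  simp only [hqs]
  rw [(hps.inner ℝ hqss).deriv]
  refine (hpt.inner ℝ hqst).congr_deriv ?_
  simp only [inner_add_left, inner_add_right, inner_neg_left, real_inner_smul_left,
    real_inner_smul_right, ContinuousLinearMap.adjoint_inner_left]
  ring
end
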